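/- arXiv:2507.07900 — 4 statements merged into one kernel-verified Lean document; each statement's English description precedes it below -/
import Mathlib

section
/- Let M, N, K be natural numbers with M, N, K ≥ 1. Let C be the M×M cyclic shift matrix (C e_j = e_{j+1 mod M} on the standard basis), let e₀ be the first standard basis vector of ℂ^M, let Π be an N×N complex orthogonal projection (Hermitian and idempotent), and let U₁, …, U_K be N×N complex matrices. For x ∈ {0,1}^{K−1} define Q(0) = Π, Q(1) = I − Π and S_x = Π · U_K · Q(x_{K−1}) · U_{K−1} ⋯ Q(x₁) · U₁ · Π. Then Π · [(e₀ᴴ ⊗ I_N) · (I_M ⊗ U_K) · ∏_{i=K−1}^{1} ((I_M ⊗ Π + C ⊗ (I−Π)) · (I_M ⊗ U_i)) · (e₀ ⊗ I_N)] · Π = Σ_{x ∈ {0,1}^{K−1}, M ∣ |x|} S_x, where |x| is the Hamming weight of x and products are taken with larger index on the left. -/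
open Kronecker

/-- The Hamming weight of a bit string. -/
def hammingWt {K : ℕ} (x : Fin K → Bool) : ℕ :=
  (Finset.univ.filter fun i => x i = true).card

/-- The matrix `S_x = Π · U_K · Q(x_{K−1}) · U_{K−1} ⋯ Q(x₁) · U₁ · Π`, where `Q(0) = Π`,
`Q(1) = I − Π`, and factors with larger index are applied on the left.
Here `U i` plays the role of `U_{i+1}` and `x i` the role of `x_{i+1}`. -/
noncomputable def Sx (N K : ℕ) (hK : 1 ≤ K) (P : Matrix (Fin N) (Fin N) ℂ)
    (U : Fin K → Matrix (Fin N) (Fin N) ℂ) (x : Fin (K - 1) → Bool) :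
    Matrix (Fin N) (Fin N) ℂ :=
  P * U ⟨K - 1, by omega⟩ *
    ((List.finRange (K - 1)).reverse.map
      (fun i => (if x i then 1 - P else P) * U (Fin.castLE (Nat.sub_le K 1) i))).prod * P

theorem hammingWt_cons {n : ℕ} (b : Bool) (x : Fin n → Bool) :
    hammingWt (Fin.cons b x : Fin (n + 1) → Bool) = hammingWt x + if b then 1 else 0 := by
  simp only [hammingWt, Finset.card_filter, Fin.sum_univ_succ, Fin.cons_zero, Fin.cons_succ]
  exact add_comm _ _

/-- An ordered product of factors `(1 ⊗ P + C ⊗ R) * (1 ⊗ V i)` expands as a sum over bit strings,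
the power of `C` counting how often the second summand was chosen. -/
theorem prod_kronecker_add_eq_sum {m ι : Type*} [Fintype m] [DecidableEq m] [Fintype ι]
    [DecidableEq ι] (C : Matrix m m ℂ) (P R : Matrix ι ι ℂ) (n : ℕ)
    (V : Fin n → Matrix ι ι ℂ) :
    ((List.finRange n).reverse.map
      (fun i => ((1 : Matrix m m ℂ) ⊗ₖ P + C ⊗ₖ R) * ((1 : Matrix m m ℂ) ⊗ₖ V i))).prod =
    ∑ x : Fin n → Bool, (C ^ hammingWt x) ⊗ₖ
      ((List.finRange n).reverse.map (fun i => (if x i then R else P) * V i)).prod := by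
  induction n with
  | zero => simp [hammingWt]
  | succ n ih =>
    rw [← (Fin.consEquiv fun _ => Bool).sum_comp, Fintype.sum_prod_type, Fintype.sum_bool]
    have hw : ∀ (b : Bool) (x : Fin n → Bool),
        hammingWt (Fin.consEquiv (fun _ => Bool) (b, x)) = hammingWt x + if b then 1 else 0 :=
      hammingWt_cons
    simp only [hw]
    have h := ih fun i => V i.succ
    simp only [List.finRange_succ, List.reverse_cons, List.map_append, List.prod_append,
      ← List.map_reverse, List.map_map, List.map_cons, List.map_nil, List.prod_cons,
      List.prod_nil, mul_one, Function.comp_def, Fin.consEquiv_apply, Fin.cons_zero,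
      Fin.cons_succ]
    rw [h, add_mul, ← Matrix.mul_kronecker_mul, ← Matrix.mul_kronecker_mul, mul_add,
      Finset.sum_mul, Finset.sum_mul, add_comm]
    simp [← Matrix.mul_kronecker_mul, pow_succ]

theorem cyclicShift_pow_apply {M : ℕ} (C : Matrix (Fin M) (Fin M) ℂ)
    (hC : ∀ i j, C i j = if (i : ℕ) = ((j : ℕ) + 1) % M then 1 else 0) (w : ℕ) (i j : Fin M) :
    (C ^ w) i j = if (i : ℕ) = ((j : ℕ) + w) % M then 1 else 0 := by
  induction w generalizing j with
  | zero => simp [Matrix.one_apply, Fin.ext_iff, Nat.mod_eq_of_lt j.isLt]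
  | succ w ih =>
    have hM : 0 < M := i.pos
    rw [pow_succ, Matrix.mul_apply,
      Finset.sum_eq_single ⟨((j : ℕ) + 1) % M, Nat.mod_lt _ hM⟩]
    · rw [ih, hC]
      simp [add_assoc, add_comm 1 w]
    · intro k _ hk
      rw [hC, if_neg fun h => hk (Fin.ext h), mul_zero]
    · simp

theorem conjTranspose_mul_kronecker_mul {m ι : Type*} [Fintype m] [DecidableEq m] [Fintype ι]
    [DecidableEq ι] (a : m) (E : Matrix (m × ι) ι ℂ)
    (hE : ∀ q j, E q j = if q.1 = a ∧ q.2 = j then 1 else 0)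
    (A : Matrix m m ℂ) (B : Matrix ι ι ℂ) :
    E.conjTranspose * (A ⊗ₖ B) * E = A a a • B := by
  ext i j
  simp [Matrix.mul_apply, Fintype.sum_prod_type, hE, ite_and, apply_ite (starRingEnd ℂ)]

/-- **The matrix block-encoded by the `p`-MACG** (with `M = 2^p`): the compression-gadget
circuit, compressed to the `e₀`-sector of the measurement register and the good subspace of
the block-encoding ancillae, equals the sum of the terms `S_x` over bit strings whose Hamming
weight is divisible by `M`. -/
theorem pMACG_block_identity (M N K : ℕ) (hM : 1 ≤ M) (hN : 1 ≤ N) (hK : 1 ≤ K)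
    (P : Matrix (Fin N) (Fin N) ℂ) (hPH : P.conjTranspose = P) (hPP : P * P = P)
    (U : Fin K → Matrix (Fin N) (Fin N) ℂ) :
    let C : Matrix (Fin M) (Fin M) ℂ :=
      Matrix.of fun i j => if (i : ℕ) = ((j : ℕ) + 1) % M then 1 else 0
    let E₀ : Matrix (Fin M × Fin N) (Fin N) ℂ :=
      Matrix.of fun q j => if (q.1 : ℕ) = 0 ∧ q.2 = j then 1 else 0
    P * (E₀.conjTranspose *
        ((1 : Matrix (Fin M) (Fin M) ℂ) ⊗ₖ U ⟨K - 1, by omega⟩) *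
        ((List.finRange (K - 1)).reverse.map
          (fun i => ((1 : Matrix (Fin M) (Fin M) ℂ) ⊗ₖ P + C ⊗ₖ (1 - P)) *
            ((1 : Matrix (Fin M) (Fin M) ℂ) ⊗ₖ U (Fin.castLE (Nat.sub_le K 1) i)))).prod *
        E₀) * P =
      ∑ x ∈ Finset.univ.filter (fun x : Fin (K - 1) → Bool => M ∣ hammingWt x),
        Sx N K hK P U x := by
  intro C E₀
  have hE : ∀ q j, E₀ q j = if q.1 = ⟨0, hM⟩ ∧ q.2 = j then 1 else 0 := fun q j => by
    simp [E₀, Fin.ext_iff]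
  rw [prod_kronecker_add_eq_sum C P (1 - P) (K - 1), Matrix.mul_sum, Matrix.sum_mul,
    Matrix.mul_sum, Matrix.sum_mul, Finset.sum_filter]
  refine Finset.sum_congr rfl fun x _ => ?_
  rw [Matrix.mul_assoc E₀.conjTranspose, ← Matrix.mul_kronecker_mul, one_mul,
    conjTranspose_mul_kronecker_mul ⟨0, hM⟩ E₀ hE,
    cyclicShift_pow_apply C (fun _ _ => rfl)]
  simp only [zero_add, Nat.dvd_iff_mod_eq_zero, eq_comm (a := 0)]
  split_ifs
  · simp only [one_smul, Sx, mul_assoc]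
  · simp
end

section
/- Let K, P be natural numbers with P ≥ 1, and let η ≥ 0 be a real number such that (η² · (K−1)/P)^P ≤ 1/2. Then Σ_{r} C(K−1, r) · η^{2r} ≤ 2 · (e · η² · K / P)^P, where the sum is over all r with 1 ≤ r ≤ K−1 that are divisible by P, and C(K−1, r) denotes the binomial coefficient. -/
/-- The `(m * P)`-th term of the binomial expansion of `(1 + y) ^ N` is at most `exp P` times the
`m`-th power of `(y * N / P) ^ P`. -/
theorem choose_mul_pow_le_exp_mul_pow {y : ℝ} (hy : 0 ≤ y) (N m : ℕ) {P : ℕ} (hP : P ≠ 0) :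
    (N.choose (m * P) : ℝ) * y ^ (m * P) ≤ Real.exp P * ((y * N / P) ^ P) ^ m := by
  have hP' : (P : ℝ) ≠ 0 := Nat.cast_ne_zero.mpr hP
  calc (N.choose (m * P) : ℝ) * y ^ (m * P)
      ≤ (N : ℝ) ^ (m * P) / (m * P).factorial * y ^ (m * P) := by
        gcongr
        exact Nat.choose_le_pow_div _ _
    _ = (P : ℝ) ^ (m * P) / (m * P).factorial * ((y * N / P) ^ P) ^ m := by
        rw [← pow_mul, mul_comm P m, div_pow, mul_pow]
        field_simp
    _ ≤ Real.exp P * ((y * N / P) ^ P) ^ m := by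
        gcongr
        exact Real.pow_div_factorial_le_exp _ (by positivity) _

/-- A finite geometric sum without constant term and with ratio `u ≤ 1 / 2` is at most `2 * u`. -/
theorem sum_range_pow_succ_le_two_mul {u : ℝ} (hu : 0 ≤ u) (hu' : u ≤ 1 / 2) (n : ℕ) :
    ∑ i ∈ Finset.range n, u ^ (i + 1) ≤ 2 * u := by
  calc ∑ i ∈ Finset.range n, u ^ (i + 1) = (∑ i ∈ Finset.range n, u ^ i) * u := by
        simp_rw [pow_succ, Finset.sum_mul]
    _ ≤ (∑ i ∈ Finset.range n, (1 / 2 : ℝ) ^ i) * u := by gcongr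
    _ ≤ 2 * u := by
        gcongr
        exact sum_geometric_two_le n

theorem filter_dvd_Icc_subset_image (N P : ℕ) :
    (Finset.Icc 1 N).filter (fun r => P ∣ r) ⊆
      (Finset.range N).image (fun m => (m + 1) * P) := by
  intro r hr
  simp only [Finset.mem_filter, Finset.mem_Icc] at hr
  obtain ⟨⟨h1, hN⟩, k, rfl⟩ := hr
  have hPk : 0 < P * k := h1
  have hk : 0 < k := Nat.pos_of_mul_pos_left hPk
  have hkN : k ≤ P * k := Nat.le_mul_of_pos_left k (Nat.pos_of_mul_pos_right hPk)
  refine Finset.mem_image.mpr ⟨k - 1, Finset.mem_range.mpr (by omega), ?_⟩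
  rw [Nat.sub_add_cancel hk, mul_comm]

/-- **Bound on the `p`-MACG error sum.** If `(η²·(K−1)/P)^P ≤ 1/2`, then the sum of
`C(K−1, r)·η^{2r}` over all `1 ≤ r ≤ K−1` divisible by `P` is at most
`2·(e·η²·K/P)^P`. -/
theorem macg_sum_bound (K P : ℕ) (hP : 1 ≤ P) (η : ℝ) (hη : 0 ≤ η)
    (hreg : (η ^ 2 * ((K : ℝ) - 1) / P) ^ P ≤ 1 / 2) :
    ∑ r ∈ (Finset.Icc 1 (K - 1)).filter (fun r => P ∣ r),
        (Nat.choose (K - 1) r : ℝ) * η ^ (2 * r) ≤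
      2 * (Real.exp 1 * η ^ 2 * K / P) ^ P := by
  rcases K with _ | N
  · simp only [zero_tsub, Finset.Icc_eq_empty_of_lt one_pos, Finset.filter_empty, Finset.sum_empty]
    positivity
  have hP0 : P ≠ 0 := Nat.one_le_iff_ne_zero.mp hP
  simp only [Nat.cast_add, Nat.cast_one, add_sub_cancel_right, Nat.add_sub_cancel] at hreg ⊢
  have hinj : Set.InjOn (fun m => (m + 1) * P) (Finset.range N : Set ℕ) := fun a _ b _ h =>
    Nat.succ_injective (Nat.eq_of_mul_eq_mul_right hP h)
  calc ∑ r ∈ (Finset.Icc 1 N).filter (fun r => P ∣ r), (N.choose r : ℝ) * η ^ (2 * r)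
      ≤ ∑ r ∈ (Finset.range N).image (fun m => (m + 1) * P), (N.choose r : ℝ) * η ^ (2 * r) :=
        Finset.sum_le_sum_of_subset_of_nonneg (filter_dvd_Icc_subset_image N P)
          fun _ _ _ => by positivity
    _ = ∑ m ∈ Finset.range N, (N.choose ((m + 1) * P) : ℝ) * (η ^ 2) ^ ((m + 1) * P) := by
        simp_rw [Finset.sum_image hinj, pow_mul η 2]
    _ ≤ ∑ m ∈ Finset.range N, Real.exp P * ((η ^ 2 * N / P) ^ P) ^ (m + 1) :=
        Finset.sum_le_sum fun m _ => choose_mul_pow_le_exp_mul_pow (sq_nonneg η) N (m + 1) hP0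
    _ ≤ Real.exp P * (2 * (η ^ 2 * N / P) ^ P) := by
        rw [← Finset.mul_sum]
        gcongr
        exact sum_range_pow_succ_le_two_mul (by positivity) hreg N
    _ = 2 * (Real.exp 1 * η ^ 2 * N / P) ^ P := by
        rw [← Real.exp_one_pow, mul_left_comm, ← mul_pow, mul_assoc (Real.exp 1), ← mul_div_assoc]
    _ ≤ 2 * (Real.exp 1 * η ^ 2 * (N + 1) / P) ^ P := by
        gcongr
        linarith
end

section
/- Let K, P, j be natural numbers with P ≥ 1, j ≥ 1 and (j+1)·P ≤ K−1, and let η ≥ 0 be a real number. Then C(K−1, (j+1)·P) · η^{2(j+1)P} ≤ C(K−1, P) · η^{2P} · ((η² · (K−1))/P)^{jP}; that is, the ratio of the (j+1)-st term to the first term in the p-MACG error sum is at most r^j where r = (η²·(K−1)/P)^P. -/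
theorem Nat.choose_add_mul_pow_le (n k m : ℕ) :
    n.choose (k + m) * k ^ m ≤ n.choose k * n ^ m := by
  induction m with
  | zero => simp
  | succ m ih =>
    calc n.choose (k + (m + 1)) * k ^ (m + 1)
        = n.choose (k + m + 1) * k * k ^ m := by rw [← add_assoc]; ring
      _ ≤ n.choose (k + m + 1) * (k + m + 1) * k ^ m := by gcongr; omega
      _ = n.choose (k + m) * (n - (k + m)) * k ^ m := by rw [Nat.choose_succ_right_eq]
      _ ≤ n.choose (k + m) * n * k ^ m := by gcongr; omega
      _ = n.choose (k + m) * k ^ m * n := by ring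
      _ ≤ n.choose k * n ^ m * n := by gcongr
      _ = n.choose k * n ^ (m + 1) := by ring

/-- **Term-ratio bound in the `p`-MACG error sum:** the `(j+1)`-st term is at most the first
term times `r^j`, where `r = (η²·(K−1)/P)^P`. -/
theorem macg_term_ratio_bound (K P j : ℕ) (hP : 1 ≤ P) (hj : 1 ≤ j)
    (hjP : (j + 1) * P ≤ K - 1) (η : ℝ) (hη : 0 ≤ η) :
    (Nat.choose (K - 1) ((j + 1) * P) : ℝ) * η ^ (2 * ((j + 1) * P)) ≤
      (Nat.choose (K - 1) P : ℝ) * η ^ (2 * P) *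
        ((η ^ 2 * ((K : ℝ) - 1)) / P) ^ (j * P) := by
  have hK : 1 ≤ K := by
    have : 0 < (j + 1) * P := by positivity
    omega
  have hPpos : (0 : ℝ) < (P : ℝ) ^ (j * P) := by positivity
  have hidx : (j + 1) * P = P + j * P := by ring
  have hchoose : ((K - 1).choose (P + j * P) : ℝ) * (P : ℝ) ^ (j * P) ≤
      ((K - 1).choose P : ℝ) * ((K : ℝ) - 1) ^ (j * P) := by
    have h := Nat.choose_add_mul_pow_le (K - 1) P (j * P)
    rw [← Nat.cast_pred hK]
    exact_mod_cast h
  rw [hidx, div_pow, ← mul_div_assoc, le_div_iff₀ hPpos]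
  calc ((K - 1).choose (P + j * P) : ℝ) * η ^ (2 * (P + j * P)) * (P : ℝ) ^ (j * P)
      = ((K - 1).choose (P + j * P) : ℝ) * (P : ℝ) ^ (j * P) * η ^ (2 * (P + j * P)) := by ring
    _ ≤ ((K - 1).choose P : ℝ) * ((K : ℝ) - 1) ^ (j * P) * η ^ (2 * (P + j * P)) := by gcongr
    _ = ((K - 1).choose P : ℝ) * η ^ (2 * P) * (η ^ 2 * ((K : ℝ) - 1)) ^ (j * P) := by
      rw [mul_pow, ← pow_mul, mul_add 2, pow_add]
      ring
end

section
/- Let K ≥ 1, let W₀, …, W_{K−1} and G₁, …, G_{K−1} and B₁, …, B_{K−1} be d_m×d_m complex unitary matrices, let U₁, …, U_K be D×D complex unitary matrices, and let Π be a D×D orthogonal projection (Hermitian and idempotent). Then there exist d_m×d_m unitary matrices Q and V₁, …, V_{K−1} such that (W_{K−1} ⊗ U_K) · ∏_{i=K−1}^{1} [(G_i ⊗ Π + I ⊗ (I−Π)) · (I ⊗ Π + B_i ⊗ (I−Π)) · (W_{i−1} ⊗ U_i)] = (Q ⊗ U_K) · ∏_{i=K−1}^{1} [(I ⊗ Π +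 V_i ⊗ (I−Π)) · (I ⊗ U_i)], where both products are taken with larger index i on the left. -/
open Kronecker

namespace Matrix

/-- One round of a coherent measurement circuit, with the good branch pulled out to the left as a
unitary `R` of the measurement register alone. -/
theorem kronecker_projection_round {m n α : Type*} [Fintype m] [DecidableEq m] [Fintype n]
    [DecidableEq n] [CommRing α] (G B W Q R V : Matrix m m α) (P U : Matrix n n α)
    (hP : P * P = P) (hR : R = G * W * Q) (hV : R * V = B * W * Q) :
    (G ⊗ₖ P + (1 : Matrix m m α) ⊗ₖ (1 - P)) * ((1 : Matrix m m α) ⊗ₖ P + B ⊗ₖ (1 - P)) *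
        (W ⊗ₖ U) * (Q ⊗ₖ (1 : Matrix n n α)) =
      (R ⊗ₖ (1 : Matrix n n α)) *
        (((1 : Matrix m m α) ⊗ₖ P + V ⊗ₖ (1 - P)) * ((1 : Matrix m m α) ⊗ₖ U)) := by
  have hPc : P * (1 - P) = 0 := by rw [mul_sub, mul_one, hP, sub_self]
  have hcP : (1 - P) * P = 0 := by rw [sub_mul, one_mul, hP, sub_self]
  have hcc : (1 - P) * (1 - P) = 1 - P := by rw [mul_sub, mul_one, hcP, sub_zero]
  simp only [add_mul, mul_add, ← mul_kronecker_mul, hP, hPc, hcP, hcc, mul_one, one_mul,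
    kronecker_zero, add_zero, zero_add, hV]
  rw [hR]

/-- The measurement-register unitaries of a product of coherent measurement rounds can be collected
into a single unitary on the left, leaving unitaries that act only on the bad subspace. -/
theorem exists_unitary_kronecker_mul_prod {m n : Type*} [Fintype m] [DecidableEq m] [Fintype n]
    [DecidableEq n] {P : Matrix n n ℂ} (hP : P * P = P) (k : ℕ)
    (W G B : Fin k → Matrix m m ℂ) (hW : ∀ i, W i ∈ unitaryGroup m ℂ)
    (hG : ∀ i, G i ∈ unitaryGroup m ℂ) (hB : ∀ i, B i ∈ unitaryGroup m ℂ)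
    (U : Fin k → Matrix n n ℂ) :
    ∃ Q ∈ unitaryGroup m ℂ, ∃ V : Fin k → Matrix m m ℂ, (∀ i, V i ∈ unitaryGroup m ℂ) ∧
      ((List.finRange k).reverse.map (fun i =>
        (G i ⊗ₖ P + (1 : Matrix m m ℂ) ⊗ₖ (1 - P)) *
        ((1 : Matrix m m ℂ) ⊗ₖ P + B i ⊗ₖ (1 - P)) * (W i ⊗ₖ U i))).prod =
      (Q ⊗ₖ (1 : Matrix n n ℂ)) *
        ((List.finRange k).reverse.map (fun i =>
          ((1 : Matrix m m ℂ) ⊗ₖ P + V i ⊗ₖ (1 - P)) * ((1 : Matrix m m ℂ) ⊗ₖ U i))).prod := by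
  induction k with
  | zero => exact ⟨1, one_mem _, 1, fun i => i.elim0, by simp⟩
  | succ k ih =>
    obtain ⟨Q, hQ, V, hV, h⟩ := ih (fun i => W i.castSucc) (fun i => G i.castSucc)
      (fun i => B i.castSucc) (fun i => hW _) (fun i => hG _) (fun i => hB _)
      (fun i => U i.castSucc)
    have hR : G (Fin.last k) * W (Fin.last k) * Q ∈ unitaryGroup m ℂ :=
      mul_mem (mul_mem (hG _) (hW _)) hQ
    have hS : B (Fin.last k) * W (Fin.last k) * Q ∈ unitaryGroup m ℂ :=
      mul_mem (mul_mem (hB _) (hW _)) hQ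
    refine ⟨_, hR, Fin.snoc (α := fun _ => Matrix m m ℂ) V
      (star (G (Fin.last k) * W (Fin.last k) * Q) * (B (Fin.last k) * W (Fin.last k) * Q)),
      fun i => ?_, ?_⟩
    · induction i using Fin.lastCases with
      | last => simpa only [Fin.snoc_last] using mul_mem (Unitary.star_mem hR) hS
      | cast i => simpa only [Fin.snoc_castSucc] using hV i
    · simp only [List.finRange_succ_last, List.reverse_append, List.reverse_singleton,
        List.singleton_append, List.map_cons, List.prod_cons, ← List.map_reverse, List.map_map,
        Function.comp_def, Fin.snoc_last, Fin.snoc_castSucc]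
      rw [h, ← mul_assoc, ← mul_assoc]
      congr 1
      exact kronecker_projection_round _ _ _ _ _ _ _ _ hP rfl
        (by rw [← mul_assoc, mem_unitaryGroup_iff.mp hR, one_mul])

end Matrix

/-- **Simplified MCM structure.** Every Multiple Coherent Measurement circuit, with
measurement-register unitaries `W₀,…,W_{K−1}`, `G₁,…,G_{K−1}`, `B₁,…,B_{K−1}`, can be
rewritten using a single final measurement-register unitary `Q` and unitaries `V₁,…,V_{K−1}`
applied only on the bad subspace.  Here `W i` plays the role of `W_i`, while `G i`, `B i`,
`V i` and `U i` play the roles of `G_{i+1}`, `B_{i+1}`, `V_{i+1}` and `U_{i+1}`;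
products are taken with larger index on the left. -/
theorem mcm_simplified_structure (dm D K : ℕ) (hK : 1 ≤ K)
    (W : Fin K → Matrix (Fin dm) (Fin dm) ℂ)
    (G B : Fin (K - 1) → Matrix (Fin dm) (Fin dm) ℂ)
    (hW : ∀ i, W i ∈ Matrix.unitaryGroup (Fin dm) ℂ)
    (hG : ∀ i, G i ∈ Matrix.unitaryGroup (Fin dm) ℂ)
    (hB : ∀ i, B i ∈ Matrix.unitaryGroup (Fin dm) ℂ)
    (U : Fin K → Matrix (Fin D) (Fin D) ℂ)
    (hU : ∀ i, U i ∈ Matrix.unitaryGroup (Fin D) ℂ)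
    (P : Matrix (Fin D) (Fin D) ℂ) (hPH : P.conjTranspose = P) (hPP : P * P = P) :
    ∃ Q : Matrix (Fin dm) (Fin dm) ℂ, Q ∈ Matrix.unitaryGroup (Fin dm) ℂ ∧
      ∃ V : Fin (K - 1) → Matrix (Fin dm) (Fin dm) ℂ,
        (∀ i, V i ∈ Matrix.unitaryGroup (Fin dm) ℂ) ∧
        (W ⟨K - 1, by omega⟩ ⊗ₖ U ⟨K - 1, by omega⟩) *
          ((List.finRange (K - 1)).reverse.map (fun i =>
            (G i ⊗ₖ P + (1 : Matrix (Fin dm) (Fin dm) ℂ) ⊗ₖ (1 - P)) *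
            ((1 : Matrix (Fin dm) (Fin dm) ℂ) ⊗ₖ P + B i ⊗ₖ (1 - P)) *
            (W (Fin.castLE (Nat.sub_le K 1) i) ⊗ₖ U (Fin.castLE (Nat.sub_le K 1) i)))).prod =
        (Q ⊗ₖ U ⟨K - 1, by omega⟩) *
          ((List.finRange (K - 1)).reverse.map (fun i =>
            ((1 : Matrix (Fin dm) (Fin dm) ℂ) ⊗ₖ P + V i ⊗ₖ (1 - P)) *
            ((1 : Matrix (Fin dm) (Fin dm) ℂ) ⊗ₖ U (Fin.castLE (Nat.sub_le K 1) i)))).prod := by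
  obtain ⟨Q, hQ, V, hV, h⟩ := Matrix.exists_unitary_kronecker_mul_prod hPP (K - 1)
    (fun i => W (Fin.castLE (Nat.sub_le K 1) i)) G B (fun i => hW _) hG hB
    (fun i => U (Fin.castLE (Nat.sub_le K 1) i))
  refine ⟨W ⟨K - 1, by omega⟩ * Q, mul_mem (hW _) hQ, V, hV, ?_⟩
  rw [h, ← mul_assoc, ← Matrix.mul_kronecker_mul, mul_one]
end
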